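/- arXiv:2307.10332 — 2 statements merged into one kernel-verified Lean document; each statement's English description precedes it below -/
import Mathlib

section
/- Let (G,W,S,⪯,s) be a POSP instance that is history-free, weakly independent and cycle-increasing. Then the instance is well-posed: the set ⋃_{v ∈ V} N_{s,v} of all nondominated weights is finite, and every chain C ⊆ W(P_s) contains a minimum element m with m ⪯ x for all x ∈ C. -/
/-- A path in the digraph with arc relation `A`: a nonempty list of vertices in which
consecutive vertices are joined by arcs. -/
def IsPath {V : Type*} (A : V → V → Prop) (p : List V) : Prop :=
  p ≠ [] ∧ p.Chain' A

/-- An `s,t`-path: a path starting at `s` and ending at `t`. -/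
def IsStPath {V : Type*} (A : V → V → Prop) (s t : V) (p : List V) : Prop :=
  IsPath A p ∧ p.head? = some s ∧ p.getLast? = some t

/-- An efficient `s,t`-path: an `s,t`-path such that no `s,t`-path has strictly
smaller weight (`W q < W p` iff `W q ⪯ W p` and `W q ≠ W p` in a partial order). -/
def EfficientPath {V S : Type*} [PartialOrder S] (A : V → V → Prop) (s : V)
    (W : List V → S) (t : V) (p : List V) : Prop :=
  IsStPath A s t p ∧ ∀ q : List V, IsStPath A s t q → ¬ W q < W p

/-- History-freeness: extensions of equal-weight `s,v`-paths along the same arc out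
of `v` have equal weight. -/
def HistoryFree {V S : Type*} (A : V → V → Prop) (s : V) (W : List V → S) : Prop :=
  ∀ v u : V, A v u → ∀ p q : List V, IsStPath A s v p → IsStPath A s v q →
    W p = W q → W (p ++ [u]) = W (q ++ [u])

/-- Weak independence: `W p ≺ W q` implies `W (p+a) ⪯ W (q+a)` for arcs `a` out of
the common endpoint. -/
def WeaklyIndependent {V S : Type*} [PartialOrder S] (A : V → V → Prop) (s : V)
    (W : List V → S) : Prop :=
  ∀ v u : V, A v u → ∀ p q : List V, IsStPath A s v p → IsStPath A s v q →
    W p < W q → W (p ++ [u]) ≤ W (q ++ [u])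

/-- Cycle-increasing: appending a cycle (a `v,v`-path of length ≥ 1, concatenated by
identifying the shared endpoint, i.e. `p ++ c.tail`) never decreases the weight. -/
def CycleIncreasing {V S : Type*} [PartialOrder S] (A : V → V → Prop) (s : V)
    (W : List V → S) : Prop :=
  ∀ v : V, ∀ p c : List V, IsStPath A s v p → IsStPath A v v c → 2 ≤ c.length →
    W p ≤ W (p ++ c.tail)

/-- The nondominated set `N_{s,t}`: weights of efficient `s,t`-paths. -/
def NondomSet {V S : Type*} [PartialOrder S] (A : V → V → Prop) (s : V)
    (W : List V → S) (t : V) : Set S :=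
  {τ | ∃ p : List V, EfficientPath A s W t p ∧ W p = τ}

/-- Well-posedness: the set of all nondominated weights is finite, and every
nonempty chain of path weights contains a minimum element. -/
def WellPosed {V S : Type*} [PartialOrder S] (A : V → V → Prop) (s : V)
    (W : List V → S) : Prop :=
  (⋃ v : V, NondomSet A s W v).Finite ∧
  ∀ C : Set S,
    C ⊆ {τ | ∃ p : List V, IsPath A p ∧ p.head? = some s ∧ W p = τ} →
    IsChain (· ≤ ·) C → C.Nonempty → ∃ m ∈ C, ∀ x ∈ C, m ≤ x

/-- `IsArcWalk A a l b`: the arcs in `l` form a walk from `a` to `b`. -/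
def IsArcWalk {V : Type*} (A : V → V → Prop) : V → List (V × V) → V → Prop
  | a, [], b => a = b
  | a, e :: l, b => e.1 = a ∧ A a e.2 ∧ IsArcWalk A e.2 l b

theorem isArcWalk_append {V : Type*} {A : V → V → Prop} {l m : List (V × V)} {a c : V} :
    IsArcWalk A a (l ++ m) c ↔ ∃ b, IsArcWalk A a l b ∧ IsArcWalk A b m c := by
  induction l generalizing a with
  | nil => simp [IsArcWalk]
  | cons e l ih => simp [IsArcWalk, ih, and_assoc]

theorem isStPath_singleton {V : Type*} (A : V → V → Prop) (s : V) : IsStPath A s s [s] := by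
  refine ⟨⟨by simp, ?_⟩, by simp, by simp⟩
  exact List.isChain_singleton s

theorem IsStPath.append_arc {V : Type*} {A : V → V → Prop} {s v u : V} {p : List V}
    (hp : IsStPath A s v p) (h : A v u) : IsStPath A s u (p ++ [u]) := by
  obtain ⟨⟨hne, hc⟩, hh, hl⟩ := hp
  refine ⟨⟨by simp, ?_⟩, by simp [hh], by simp⟩
  refine List.isChain_append.2 ⟨hc, List.isChain_singleton u, ?_⟩
  intro x hx y hy
  simp_all

theorem IsStPath.append_walk {V : Type*} {A : V → V → Prop} {s v t : V} {p : List V}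
    {l : List (V × V)} (hp : IsStPath A s v p) (hl : IsArcWalk A v l t) :
    IsStPath A s t (p ++ l.map Prod.snd) := by
  induction l generalizing v p with
  | nil => cases hl; simpa using hp
  | cons e l ih => simpa using ih (hp.append_arc hl.2.1) hl.2.2

theorem IsStPath.exists_isArcWalk {V : Type*} {A : V → V → Prop} {s t : V} {p : List V}
    (hp : IsStPath A s t p) : ∃ l, IsArcWalk A s l t ∧ s :: l.map Prod.snd = p := by
  induction p generalizing s with
  | nil => exact absurd rfl hp.1.1
  | cons a p ih =>
    obtain ⟨⟨-, hc⟩, hh, hl⟩ := hp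
    obtain rfl : a = s := by simpa using hh
    cases p with
    | nil => exact ⟨[], by simpa [IsArcWalk] using hl, rfl⟩
    | cons b p =>
      have hc' := List.isChain_cons_cons.1 hc
      obtain ⟨l, hw, hm⟩ := ih (s := b) ⟨⟨by simp, hc'.2⟩, rfl, by simpa using hl⟩
      exact ⟨(a, b) :: l, ⟨rfl, hc'.1, hw⟩, by simp [hm]⟩

section Weights

variable {V S : Type*} [PartialOrder S] {A : V → V → Prop} {s : V} {W : List V → S}

theorem weight_append_walk_le (hHF : HistoryFree A s W) (hWI : WeaklyIndependent A s W)
    {v t : V} {p q : List V} {l : List (V × V)} (hp : IsStPath A s v p)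
    (hq : IsStPath A s v q) (hpq : W p ≤ W q) (hl : IsArcWalk A v l t) :
    W (p ++ l.map Prod.snd) ≤ W (q ++ l.map Prod.snd) := by
  induction l generalizing v p q with
  | nil => simpa using hpq
  | cons e l ih =>
    have h : W (p ++ [e.2]) ≤ W (q ++ [e.2]) := by
      rcases hpq.eq_or_lt with h | h
      · exact (hHF v e.2 hl.2.1 p q hp hq h).le
      · exact hWI v e.2 hl.2.1 p q hp hq h
    simpa using ih (hp.append_arc hl.2.1) (hq.append_arc hl.2.1) h hl.2.2

theorem weight_le_append_closed_walk (hCI : CycleIncreasing A s W) {v : V} {p : List V}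
    {l : List (V × V)} (hp : IsStPath A s v p) (hl : IsArcWalk A v l v) :
    W p ≤ W (p ++ l.map Prod.snd) := by
  cases l with
  | nil => simp
  | cons e l =>
    exact hCI v p ([v] ++ (e :: l).map Prod.snd) hp
      ((isStPath_singleton A v).append_walk hl) (by simp)

/-- The gaps of an embedding of arc sequences with common endpoints are closed walks, so the
weight is monotone along such embeddings. -/
theorem weight_append_le_of_sublist (hHF : HistoryFree A s W) (hWI : WeaklyIndependent A s W)
    (hCI : CycleIncreasing A s W) {v t : V} {p : List V} {l m : List (V × V)}
    (hp : IsStPath A s v p) (hl : IsArcWalk A v l t) (hm : IsArcWalk A v m t)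
    (hlm : l.Sublist m) : W (p ++ l.map Prod.snd) ≤ W (p ++ m.map Prod.snd) := by
  induction l generalizing v p m with
  | nil =>
    cases hl
    simpa using weight_le_append_closed_walk hCI hp hm
  | cons e l ih =>
    obtain ⟨r₁, r₂, rfl, he, hlr⟩ := List.cons_sublist_iff.1 hlm
    obtain ⟨d, r, rfl⟩ := List.append_of_mem he
    rw [List.append_assoc, isArcWalk_append] at hm
    obtain ⟨b, hd, hr⟩ := hm
    obtain rfl : v = b := hl.1.symm.trans hr.1
    have hpd := hp.append_walk hd
    calc W (p ++ (e :: l).map Prod.snd)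
        ≤ W ((p ++ d.map Prod.snd) ++ (e :: l).map Prod.snd) :=
          weight_append_walk_le hHF hWI hp hpd (weight_le_append_closed_walk hCI hp hd) hl
      _ = W (((p ++ d.map Prod.snd) ++ [e.2]) ++ l.map Prod.snd) := by simp
      _ ≤ W (((p ++ d.map Prod.snd) ++ [e.2]) ++ (r ++ r₂).map Prod.snd) :=
          ih (hpd.append_arc hl.2.1) hl.2.2 hr.2.2
            (hlr.trans (List.sublist_append_right r r₂))
      _ = W (p ++ ((d ++ e :: r) ++ r₂).map Prod.snd) := by simp

theorem isPWO_weights [Finite V] (hHF : HistoryFree A s W) (hWI : WeaklyIndependent A s W)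
    (hCI : CycleIncreasing A s W) (t : V) : (W '' {p | IsStPath A s t p}).IsPWO := by
  have hfin : (Set.univ : Set (V × V)).PartiallyWellOrderedOn Eq :=
    Set.finite_univ.partiallyWellOrderedOn
  have hwalks : {l | IsArcWalk A s l t}.PartiallyWellOrderedOn (List.SublistForall₂ Eq) :=
    (hfin.partiallyWellOrderedOn_sublistForall₂ Eq).mono fun _ _ _ _ => Set.mem_univ _
  have himage : ((fun l => W ([s] ++ l.map Prod.snd)) '' {l | IsArcWalk A s l t}).IsPWO := by
    refine hwalks.image_of_monotone_on fun l hl m hm hlm => ?_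
    obtain ⟨k, hk, hkm⟩ := List.sublistForall₂_iff.1 hlm
    rw [List.forall₂_eq_eq_eq] at hk
    subst hk
    exact weight_append_le_of_sublist hHF hWI hCI (isStPath_singleton A s) hl hm hkm
  refine himage.mono ?_
  rintro _ ⟨p, hp, rfl⟩
  obtain ⟨l, hl, rfl⟩ := hp.exists_isArcWalk
  exact ⟨l, hl, rfl⟩

end Weights

/-- A history-free, weakly independent, cycle-increasing POSP
instance is well-posed. -/
theorem hf_wi_ci_implies_wellPosed
    {V S : Type*} [Fintype V] [Nonempty V] [PartialOrder S]
    (A : V → V → Prop) (s : V) (W : List V → S)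
    (hHF : HistoryFree A s W) (hWI : WeaklyIndependent A s W)
    (hCI : CycleIncreasing A s W) :
    WellPosed A s W := by
  have hpwo := isPWO_weights hHF hWI hCI
  refine ⟨Set.finite_iUnion fun v => ?_, fun C hC hchain hne => ?_⟩
  · have hsub : NondomSet A s W v ⊆ W '' {p | IsStPath A s v p} := by
      rintro _ ⟨p, hp, rfl⟩
      exact ⟨p, hp.1, rfl⟩
    have hanti : IsAntichain (· ≤ ·) (NondomSet A s W v) := by
      rintro _ ⟨p, hp, rfl⟩ _ ⟨q, hq, rfl⟩ hpq hle
      exact hq.2 p hp.1 (lt_of_le_of_ne hle hpq)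
    have hN := (hpwo v).mono hsub
    exact hanti.finite_of_partiallyWellOrderedOn hN
  · have hall : (⋃ v, W '' {p | IsStPath A s v p}).IsPWO := by
      have h := (Finset.isPWO_bUnion (Finset.univ : Finset V)).2 fun v _ => hpwo v
      simpa using h
    have hCpwo : C.IsPWO := hall.mono fun x hx => by
      obtain ⟨p, hp, hs, rfl⟩ := hC hx
      exact Set.mem_iUnion.2
        ⟨p.getLast hp.1, p, ⟨hp, hs, List.getLast?_eq_some_getLast hp.1⟩, rfl⟩
    obtain ⟨m, hm⟩ := hCpwo.exists_minimal hne
    refine ⟨m, hm.1, fun x hx => ?_⟩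
    rcases hchain.total hm.1 hx with h | h
    · exact h
    · exact hm.2 hx h
end

section
/- Let (G,W,S,⪯,s) be a POSP instance that is well-posed, history-free, weakly independent and μ-bounded for some μ > 0. Then the instance is weakly subpath optimal. -/
/-- A path `p = (v₁,…,vₙ)` is subpath optimal if every prefix `(v₁,…,vᵢ)` is an
efficient `s,vᵢ`-path. -/
def SubpathOptimalPath {V S : Type*} [PartialOrder S] (A : V → V → Prop) (s : V)
    (W : List V → S) (p : List V) : Prop :=
  ∀ (i : ℕ) (h : i < p.length), EfficientPath A s W (p[i]'h) (p.take (i + 1))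

/-- Weak subpath optimality of the instance: every efficient `s,t`-path has an
equal-weight `s,t`-path all of whose prefixes are efficient. -/
def WeaklySubpathOptimal {V S : Type*} [PartialOrder S] (A : V → V → Prop) (s : V)
    (W : List V → S) : Prop :=
  ∀ (t : V) (p : List V), EfficientPath A s W t p →
    ∃ q : List V, IsStPath A s t q ∧ W q = W p ∧ SubpathOptimalPath A s W q

/-- `μ`-boundedness: no efficient path has length (number of arcs) exceeding `μ`. -/
def MuBounded {V S : Type*} [PartialOrder S] (A : V → V → Prop) (s : V)
    (W : List V → S) (μ : ℕ) : Prop :=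
  ∀ (t : V) (p : List V), EfficientPath A s W t p → p.length - 1 ≤ μ

/-- `EfficientExt A s W t v a l`: following the vertices of `l` one after the other, starting from
the path `a` with endpoint `v`, leads to `t`, and every nonempty extension of `a` met on the way
is efficient. -/
inductive EfficientExt {V S : Type*} [PartialOrder S] (A : V → V → Prop) (s : V)
    (W : List V → S) (t : V) : V → List V → List V → Prop
  | nil (a : List V) : EfficientExt A s W t t a []
  | cons {v u : V} {a l : List V} (hA : A v u) (hE : EfficientPath A s W u (a ++ [u]))
      (hl : EfficientExt A s W t u (a ++ [u]) l) : EfficientExt A s W t v a (u :: l)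

section

variable {V S : Type*} {A : V → V → Prop} {s : V} {W : List V → S}

theorem IsStPath.concat {v u : V} {p : List V} (hp : IsStPath A s v p) (hA : A v u) :
    IsStPath A s u (p ++ [u]) := by
  obtain ⟨⟨hne, hc⟩, hh, hl⟩ := hp
  refine ⟨⟨by simp, ?_⟩, ?_, by simp⟩
  · refine List.isChain_append.2 ⟨hc, List.isChain_singleton u, ?_⟩
    intro x hx y hy
    simp_all
  · rw [List.head?_append_of_ne_nil _ hne, hh]

theorem IsStPath.eq_singleton_or_concat {v : V} {p : List V} (hp : IsStPath A s v p) :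
    (p = [s] ∧ v = s) ∨ ∃ w b, p = b ++ [v] ∧ IsStPath A s w b ∧ A w v := by
  obtain ⟨⟨hne, hc⟩, hh, hl⟩ := hp
  obtain ⟨b, rfl⟩ : ∃ b, p = b ++ [v] :=
    ⟨p.dropLast, (List.dropLast_append_getLast? v hl).symm⟩
  rcases List.eq_nil_or_concat' b with rfl | ⟨c, w, rfl⟩
  · left
    simp_all
  · right
    obtain ⟨hcb, -, harc⟩ := List.isChain_append.1 hc
    refine ⟨w, c ++ [w], rfl, ⟨⟨by simp, hcb⟩, ?_, by simp⟩, harc w (by simp) v (by simp)⟩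
    rwa [List.head?_append_of_ne_nil _ (by simp)] at hh

variable [PartialOrder S]

theorem EfficientPath.of_le {t : V} {p q : List V} (hp : EfficientPath A s W t p)
    (hq : IsStPath A s t q) (hle : W q ≤ W p) : EfficientPath A s W t q ∧ W q = W p := by
  have heq : W q = W p := hle.eq_of_not_lt (hp.2 q hq)
  exact ⟨⟨hq, fun r hr => heq ▸ hp.2 r hr⟩, heq⟩

theorem WellPosed.exists_efficientPath_le (hWP : WellPosed A s W) {t : V} {p : List V}
    (hp : IsStPath A s t p) : ∃ q, EfficientPath A s W t q ∧ W q ≤ W p := by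
  obtain ⟨m, hpm, hm⟩ := zorn_le_nonempty₀ (α := Sᵒᵈ) {x | ∃ q, IsStPath A s t q ∧ W q = x}
    (fun C hC hchain y hy => by
      obtain ⟨m, hmC, hm⟩ := hWP.2 C
        (fun x hx => by
          obtain ⟨q, hq, hqx⟩ := hC hx
          exact ⟨q, hq.1, hq.2.1, hqx⟩)
        hchain.symm ⟨y, hy⟩
      exact ⟨m, hC hmC, hm⟩)
    (W p) ⟨p, hp, rfl⟩
  obtain ⟨q, hq, rfl⟩ := hm.prop
  exact ⟨q, ⟨hq, fun r hr hlt => hlt.not_ge (hm.2 ⟨r, hr, rfl⟩ hlt.le)⟩, hpm⟩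

theorem EfficientExt.of_le (hHF : HistoryFree A s W) (hWI : WeaklyIndependent A s W)
    {t v : V} {a l r : List V} (h : EfficientExt A s W t v a l) (ha : IsStPath A s v a)
    (hr : IsStPath A s v r) (hle : W r ≤ W a) (hE : EfficientPath A s W t (a ++ l)) :
    EfficientExt A s W t v r l ∧ EfficientPath A s W t (r ++ l) ∧ W (r ++ l) = W (a ++ l) := by
  induction h generalizing r with
  | nil a =>
    simp only [List.append_nil] at hE ⊢
    exact ⟨.nil r, hE.of_le hr hle⟩
  | @cons v u a l hA hau _ ih =>
    have hle' : W (r ++ [u]) ≤ W (a ++ [u]) := by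
      rcases hle.eq_or_lt with h | h
      · exact (hHF v u hA r a hr ha h).le
      · exact hWI v u hA r a hr ha h
    obtain ⟨h₁, h₂, h₃⟩ := ih hau.1 (hr.concat hA) hle' (by simpa using hE)
    exact ⟨.cons hA (hau.of_le (hr.concat hA) hle').1 h₁, by simpa using h₂, by simpa using h₃⟩

theorem SubpathOptimalPath.concat {u : V} {p : List V} (hp : SubpathOptimalPath A s W p)
    (hE : EfficientPath A s W u (p ++ [u])) : SubpathOptimalPath A s W (p ++ [u]) := by
  intro i hi
  rcases Nat.lt_or_ge i p.length with h | h
  · rw [List.getElem_append_left h, List.take_append_of_le_length h]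
    exact hp i h
  · obtain rfl : i = p.length := by
      simp only [List.length_append, List.length_singleton] at hi
      omega
    rw [List.take_of_length_le (by simp)]
    simpa using hE

theorem EfficientExt.subpathOptimalPath {t v : V} {a l : List V}
    (h : EfficientExt A s W t v a l) (ha : SubpathOptimalPath A s W a) :
    SubpathOptimalPath A s W (a ++ l) := by
  induction h with
  | nil a => simpa using ha
  | cons _ hau _ ih => simpa using ih (ha.concat hau)

theorem EfficientExt.exists_subpathOptimalPath {μ : ℕ} (hWP : WellPosed A s W)
    (hHF : HistoryFree A s W) (hWI : WeaklyIndependent A s W) (hB : MuBounded A s W μ) {t : V}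
    (n : ℕ) {v : V} {a l : List V} (h : EfficientExt A s W t v a l) (ha : IsStPath A s v a)
    (hE : EfficientPath A s W t (a ++ l)) (hn : μ + 1 < l.length + n) :
    ∃ q, IsStPath A s t q ∧ W q = W (a ++ l) ∧ SubpathOptimalPath A s W q := by
  induction n generalizing v a l with
  | zero =>
    have := hB t _ hE
    simp only [List.length_append] at this
    omega
  | succ n ih =>
    obtain ⟨r, hr, hle⟩ := hWP.exists_efficientPath_le ha
    obtain ⟨hext, hEr, hW⟩ := h.of_le hHF hWI ha hr.1 hle hE
    rcases hr.1.eq_singleton_or_concat with ⟨rfl, rfl⟩ | ⟨w, b, rfl, hb, hA⟩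
    · refine ⟨_, hEr.1, hW, hext.subpathOptimalPath fun i hi => ?_⟩
      obtain rfl : i = 0 := by simpa using hi
      simpa using hr
    · rw [← hW]
      simpa using ih (.cons hA hr hext) hb (by simpa using hEr)
        (by simp only [List.length_cons]; omega)

end

/-- A well-posed, history-free, weakly independent and `μ`-bounded
POSP instance (for some `μ > 0`) is weakly subpath optimal. -/
theorem wp_hf_wi_muBounded_implies_wso
    {V S : Type*} [Fintype V] [Nonempty V] [PartialOrder S]
    (A : V → V → Prop) (s : V) (W : List V → S) (μ : ℕ) (hμ : 0 < μ)
    (hWP : WellPosed A s W) (hHF : HistoryFree A s W)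
    (hWI : WeaklyIndependent A s W) (hB : MuBounded A s W μ) :
    WeaklySubpathOptimal A s W := by
  intro t p hp
  simpa using (EfficientExt.nil p).exists_subpathOptimalPath hWP hHF hWI hB (μ + 2) hp.1
    (by simpa using hp) (by simp)
end
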